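/- For every natural number n, f_n^-(x) = Σ_{k=0}^n (−1)^{n−k} (n choose k) B_k^-(x). -/

import Mathlib

open Polynomial Finset

/-- A signed permutation of `[n]`, encoded by its word: position `i` (0-indexed)
holds the pair (absolute value minus one, sign) of the letter `w(a_{i+1})`. -/
def IsSP {n : ℕ} (u : Fin n → Fin n × Bool) : Prop :=
  Function.Bijective fun i => (u i).1

instance {n : ℕ} (u : Fin n → Fin n × Bool) : Decidable (IsSP u) :=
  inferInstanceAs (Decidable (Function.Bijective _))

/-- the letter `w(a_{i+1})` at position `i` of the word -/
def letterW {n : ℕ} (u : Fin n → Fin n × Bool) (i : Fin n) : ℤ :=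
  if (u i).2 then ((u i).1 : ℤ) + 1 else -(((u i).1 : ℤ) + 1)

/-- `a_{k+1}`: the element of the domain `S` with absolute value `k+1` -/
def aVal {n : ℕ} (u : Fin n → Fin n × Bool) (k : Fin n) : ℤ :=
  if ∃ j, u j = (k, true) then ((k : ℤ) + 1) else -((k : ℤ) + 1)

/-- the number of type `B` excedances -/
def excB {n : ℕ} (u : Fin n → Fin n × Bool) : ℕ :=
  (univ.filter fun k : Fin n =>
    aVal u k < letterW u k ∨ (aVal u k < 0 ∧ letterW u k = aVal u k)).card

/-- a derangement: no positive fixed point -/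
def IsDerB {n : ℕ} (u : Fin n → Fin n × Bool) : Prop :=
  ∀ k : Fin n, 0 < aVal u k → letterW u k ≠ aVal u k

instance {n : ℕ} (u : Fin n → Fin n × Bool) : Decidable (IsDerB u) := by
  unfold IsDerB; infer_instance

/-- the type `B` derangement polynomial -/
noncomputable def dB (n : ℕ) : Polynomial ℝ :=
  ∑ u ∈ univ.filter (fun u : Fin n → Fin n × Bool => IsSP u ∧ IsDerB u), X ^ excB u

/-- the number of type `B` descents -/
def desB {n : ℕ} (u : Fin n → Fin n × Bool) : ℕ :=
  (univ.filter fun i : Fin n =>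
    ((i : ℕ) = 0 ∧ letterW u i < 0) ∨
    (0 < (i : ℕ) ∧ letterW u i < letterW u ⟨(i : ℕ) - 1, by have := i.isLt; omega⟩)).card

/-- the type `B` Eulerian polynomial -/
noncomputable def Bpoly (n : ℕ) : Polynomial ℝ :=
  ∑ u ∈ univ.filter (fun u : Fin n → Fin n × Bool => IsSP u), X ^ desB u

/-- the "positive half" type `B` Eulerian polynomial -/
noncomputable def Bplus : ℕ → Polynomial ℝ
  | 0 => 1
  | n + 1 =>
    ∑ u ∈ univ.filter (fun u : Fin (n + 1) → Fin (n + 1) × Bool =>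
        IsSP u ∧ 0 < letterW u (Fin.last n)), X ^ desB u

/-- the "negative half" type `B` Eulerian polynomial -/
noncomputable def Bminus : ℕ → Polynomial ℝ
  | 0 => 0
  | n + 1 =>
    ∑ u ∈ univ.filter (fun u : Fin (n + 1) → Fin (n + 1) × Bool =>
        IsSP u ∧ letterW u (Fin.last n) < 0), X ^ desB u

/-- the number of excedances of a permutation -/
def excA {n : ℕ} (w : Equiv.Perm (Fin n)) : ℕ :=
  (univ.filter fun i : Fin n => i < w i).card

/-- the number of descents of a permutation -/
def desA {n : ℕ} (w : Equiv.Perm (Fin n)) : ℕ :=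
  (univ.filter fun i : Fin n =>
    (i : ℕ) + 1 < n ∧ w ⟨((i : ℕ) + 1) % n, Nat.mod_lt _ i.pos⟩ < w i).card

/-- the (type `A`) derangement polynomial -/
noncomputable def dA (n : ℕ) : Polynomial ℝ :=
  ∑ w ∈ univ.filter (fun w : Equiv.Perm (Fin n) => ∀ i, w i ≠ i), X ^ excA w

/-- the Eulerian polynomial, with the convention `A_0 = 0` -/
noncomputable def Apoly (n : ℕ) : Polynomial ℝ :=
  if n = 0 then 0 else ∑ w : Equiv.Perm (Fin n), X ^ desA w


/-! ### Alternating binomial transform -/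

noncomputable def altT (a : ℕ → Polynomial ℝ) (n : ℕ) : Polynomial ℝ :=
  ∑ k ∈ Finset.range (n + 1), (-1 : Polynomial ℝ) ^ (n - k) * (n.choose k : Polynomial ℝ) * a k

lemma altT_succ (a : ℕ → Polynomial ℝ) (n : ℕ) :
    altT a (n + 1) = altT (fun k => a (k + 1)) n - altT a n := by
  unfold altT
  have h1 : ∑ k ∈ Finset.range (n + 1), (-1 : Polynomial ℝ) ^ (n - k) *
      (n.choose k : Polynomial ℝ) * a k =
      ∑ k ∈ Finset.range (n + 1), (-1 : Polynomial ℝ) ^ (n - (k + 1)) *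
      (n.choose (k + 1) : Polynomial ℝ) * a (k + 1) + (-1) ^ n * a 0 := by
    have := Finset.sum_range_succ' (fun k => (-1 : Polynomial ℝ) ^ (n - k) *
      (n.choose k : Polynomial ℝ) * a k) (n + 1)
    rw [Finset.sum_range_succ] at this
    simpa using this
  rw [Finset.sum_range_succ' _ (n + 1), h1, ← sub_sub, ← Finset.sum_sub_distrib]
  have h2 : (-1 : Polynomial ℝ) ^ (n + 1 - 0) * ((n + 1).choose 0 : Polynomial ℝ) * a 0
      = - ((-1) ^ n * a 0) := by
    simp [pow_succ]
  rw [h2, sub_eq_add_neg]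
  congr 1
  apply Finset.sum_congr rfl
  intro k hk
  rw [Nat.choose_succ_succ]
  have hk' : k ≤ n := by simpa [Nat.lt_succ_iff] using hk
  rcases hk'.lt_or_eq with h | h
  · obtain ⟨m, rfl⟩ : ∃ m, n = k + 1 + m := ⟨n - (k + 1), by omega⟩
    have e1 : k + 1 + m + 1 - (k + 1) = m + 1 := by omega
    have e2 : k + 1 + m - k = m + 1 := by omega
    have e3 : k + 1 + m - (k + 1) = m := by omega
    rw [e1, e2, e3]
    push_cast
    ring
  · subst h
    simp

lemma altT_mul (a : ℕ → Polynomial ℝ) (n : ℕ) :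
    altT (fun k => (k : Polynomial ℝ) * a k) n =
      n * altT a n + n * altT a (n - 1) := by
  cases n with
  | zero => simp [altT]
  | succ n =>
    have h1 : altT a (n + 1 - 1) = - ∑ k ∈ Finset.range (n + 2), (-1 : Polynomial ℝ) ^ (n + 1 - k) *
      (n.choose k : Polynomial ℝ) * a k := by
      rw [Finset.sum_range_succ]
      simp only [Nat.choose_succ_self, altT, Nat.add_sub_cancel]
      simp only [Nat.cast_zero, mul_zero, zero_mul, add_zero]
      rw [← Finset.sum_neg_distrib]
      apply Finset.sum_congr rfl
      intro k hk
      have : n + 1 - k = (n - k) + 1 := by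
        have := Finset.mem_range.1 hk
        omega
      rw [this]; ring
    rw [h1]
    simp only [altT]
    rw [mul_neg, ← sub_eq_add_neg, Finset.mul_sum, Finset.mul_sum, ← Finset.sum_sub_distrib]
    apply Finset.sum_congr rfl
    intro k hk
    have hk' : k ≤ n + 1 := by simpa [Nat.lt_succ_iff] using hk
    have key : (k : Polynomial ℝ) * ((n + 1).choose k : Polynomial ℝ) + (n + 1) * (n.choose k : Polynomial ℝ)
        = (n + 1) * ((n + 1).choose k : Polynomial ℝ) := by
      have h' := Nat.choose_mul_succ_eq n k
      have : k * (n + 1).choose k + (n + 1) * n.choose k = (n + 1) * (n + 1).choose k := by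
        rw [mul_comm (n + 1) (n.choose k), h', mul_comm _ (n + 1 - k), ← add_mul]
        congr 1; omega
      exact_mod_cast this
    push_cast
    linear_combination (-1 : Polynomial ℝ) ^ (n + 1 - k) * a k * key

lemma altT_derivative (a : ℕ → Polynomial ℝ) (n : ℕ) :
    altT (fun k => derivative (a k)) n = derivative (altT a n) := by
  unfold altT
  rw [derivative_sum]
  apply Finset.sum_congr rfl
  intro k _
  have : (-1 : Polynomial ℝ) ^ (n - k) * (n.choose k : Polynomial ℝ)
    = C ((-1 : ℝ) ^ (n - k) * (n.choose k : ℝ)) := by simp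
  rw [this, derivative_C_mul]

lemma altT_add (a b : ℕ → Polynomial ℝ) (n : ℕ) :
    altT (fun k => a k + b k) n = altT a n + altT b n := by
  simp [altT, mul_add, Finset.sum_add_distrib]

lemma altT_smul (c : Polynomial ℝ) (a : ℕ → Polynomial ℝ) (n : ℕ) :
    altT (fun k => c * a k) n = c * altT a n := by
  simp only [altT, Finset.mul_sum]
  apply Finset.sum_congr rfl
  intro k _
  ring

/-- General recurrence transfer. -/
lemma altT_rec (a c : ℕ → Polynomial ℝ)
    (h : ∀ n, a (n + 1) = 2 * X * (1 - X) * derivative (a n) + 2 * X * ((n : Polynomial ℝ) * a n) + c n) (n : ℕ) :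
    altT a (n + 1) = 2 * X * (1 - X) * derivative (altT a n)
      + 2 * X * ((n : Polynomial ℝ) * altT a n + (n : Polynomial ℝ) * altT a (n - 1)) + altT c n - altT a n := by
  rw [altT_succ]
  have : (fun k => a (k + 1)) = fun k =>
      ((2 * X * (1 - X) * derivative (a k) + 2 * X * ((k : Polynomial ℝ) * a k)) + c k) := funext h
  rw [this, altT_add, altT_add, altT_smul, altT_smul, altT_derivative, altT_mul]

/-! ### Palindromic polynomials -/

def Pal (N : ℕ) (g : Polynomial ℝ) : Prop :=
  (∀ i j, i + j = N → g.coeff i = g.coeff j) ∧ ∀ i, N < i → g.coeff i = 0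

lemma Pal.add {N : ℕ} {g h : Polynomial ℝ} (hg : Pal N g) (hh : Pal N h) : Pal N (g + h) :=
  ⟨fun i j e => by simp [hg.1 i j e, hh.1 i j e], fun i hi => by simp [hg.2 i hi, hh.2 i hi]⟩

lemma Pal.smul {N : ℕ} {g : Polynomial ℝ} (hg : Pal N g) (c : ℝ) : Pal N (C c * g) :=
  ⟨fun i j e => by simp [hg.1 i j e], fun i hi => by simp [hg.2 i hi]⟩

lemma Pal.zero (N : ℕ) : Pal N 0 := ⟨fun i j e => by simp, fun i hi => by simp⟩

lemma Pal.X_mul {N : ℕ} {g : Polynomial ℝ} (hg : Pal N g) : Pal (N + 2) (X * g) := by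
  refine ⟨fun i j e => ?_, fun i hi => ?_⟩
  · rcases i with _ | i
    · obtain rfl : j = (N + 1) + 1 := by omega
      simp [coeff_X_mul, hg.2 (N + 1)]
    · rcases j with _ | j
      · obtain rfl : i = N + 1 := by omega
        simp [coeff_X_mul, hg.2 (N + 1)]
      · rw [coeff_X_mul, coeff_X_mul]
        exact hg.1 _ _ (by omega)
  · obtain ⟨i, rfl⟩ : ∃ k, i = k + 1 := ⟨i - 1, by omega⟩
    rw [coeff_X_mul]
    exact hg.2 _ (by omega)

lemma Pal.one_add_X_mul {N : ℕ} {g : Polynomial ℝ} (hg : Pal N g) : Pal (N + 1) ((1 + X) * g) := by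
  have e : (1 + X) * g = g + X * g := by ring
  rw [e]
  refine ⟨fun i j e => ?_, fun i hi => ?_⟩
  · rcases i with _ | i
    · obtain rfl : j = N + 1 := by omega
      simp [coeff_X_mul, hg.2 (N + 1), hg.1 0 N]
    · rcases j with _ | j
      · obtain rfl : i = N := by omega
        simp [coeff_X_mul, hg.2 (i + 1), hg.1 0 i]
      · rw [coeff_add, coeff_add, coeff_X_mul, coeff_X_mul, hg.1 (i + 1) j (by omega),
          hg.1 i (j + 1) (by omega), add_comm]
  · obtain ⟨i, rfl⟩ : ∃ k, i = k + 1 := ⟨i - 1, by omega⟩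
    rw [coeff_add, coeff_X_mul, hg.2 _ (by omega), hg.2 _ (by omega), add_zero]

lemma coeff_euler_zero (N : ℕ) (g : Polynomial ℝ) :
    (X * (1 - X) * derivative g + X * ((N : Polynomial ℝ) * g)).coeff 0 = 0 := by
  simp [mul_assoc]

lemma coeff_euler_succ (N : ℕ) (g : Polynomial ℝ) (i : ℕ) :
    (X * (1 - X) * derivative g + X * ((N : Polynomial ℝ) * g)).coeff (i + 1)
      = (i + 1) * g.coeff (i + 1) + (N - i) * g.coeff i := by
  have e : X * (1 - X) * derivative g + X * ((N : Polynomial ℝ) * g)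
    = X * (derivative g - X * derivative g + C (N : ℝ) * g) := by simp; ring
  rw [e, coeff_X_mul, coeff_add, coeff_sub, coeff_C_mul, coeff_derivative]
  rcases i with _ | i
  · simp
  · rw [coeff_X_mul, coeff_derivative]; push_cast; ring

lemma Pal.euler {N : ℕ} {g : Polynomial ℝ} (hg : Pal N g) :
    Pal (N + 1) (X * (1 - X) * derivative g + X * ((N : Polynomial ℝ) * g)) := by
  have top : ∀ i, N ≤ i →
      (X * (1 - X) * derivative g + X * ((N : Polynomial ℝ) * g)).coeff (i + 1) = 0 := by
    intro i hi
    rw [coeff_euler_succ, hg.2 (i + 1) (by omega)]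
    rcases hi.lt_or_eq with h | h
    · rw [hg.2 _ h]; simp
    · subst h; simp
  refine ⟨fun i j e => ?_, fun i hi => ?_⟩
  · rcases i with _ | i
    · obtain rfl : j = N + 1 := by omega
      rw [top N le_rfl, coeff_euler_zero]
    · rcases j with _ | j
      · obtain rfl : i = N := by omega
        rw [top i le_rfl, coeff_euler_zero]
      · rw [coeff_euler_succ, coeff_euler_succ, hg.1 (i + 1) j (by omega),
          hg.1 i (j + 1) (by omega)]
        have : (N : ℝ) = i + j + 1 := by exact_mod_cast (show N = i + j + 1 by omega)
        rw [this]; ring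
  · obtain ⟨i, rfl⟩ : ∃ k, i = k + 1 := ⟨i - 1, by omega⟩
    exact top _ (by omega)

lemma Pal.eq_zero {N : ℕ} {g : Polynomial ℝ} (h : Pal N g) (h' : Pal (N + 1) g) : g = 0 := by
  have key : ∀ i, g.coeff i = 0 := by
    have h0 : g.coeff 0 = 0 := by rw [h'.1 0 (N + 1) (by omega)]; exact h.2 _ (by omega)
    intro i
    induction i with
    | zero => exact h0
    | succ i ih =>
      by_cases hi : i ≤ N
      · rw [h'.1 (i + 1) (N - i) (by omega), ← h.1 i (N - i) (by omega), ih]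
      · exact h.2 _ (by omega)
  ext i
  simp [key i]

/-- The algebraic core. -/
lemma altT_pal (bp bm : ℕ → Polynomial ℝ) (hp0 : bp 0 = 1) (hm0 : bm 0 = 0)
    (hp : ∀ n, bp (n + 1) = 2 * X * (1 - X) * derivative (bp n) + 2 * X * ((n : Polynomial ℝ) * bp n)
      + (bp n + bm n))
    (hm : ∀ n, bm (n + 1) = 2 * X * (1 - X) * derivative (bm n) + 2 * X * ((n : Polynomial ℝ) * bm n)
      + X * (bp n + bm n)) (n : ℕ) :
    Pal n (altT bp n) ∧ Pal (n + 1) (altT bm n) := by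
  have rp := altT_rec bp _ hp
  have rm := altT_rec bm _ hm
  simp only [altT_add, altT_smul] at rp rm
  induction n using Nat.strong_induction_on with
  | _ n ih =>
  rcases n with _ | n
  · constructor
    · have e0 : altT bp 0 = 1 := by simp [altT, hp0]
      rw [e0]
      refine ⟨fun i j e => ?_, fun i hi => ?_⟩
      · obtain ⟨rfl, rfl⟩ : i = 0 ∧ j = 0 := by omega
        rfl
      · rw [coeff_one, if_neg (by omega)]
    · have e0 : altT bm 0 = 0 := by simp [altT, hm0]
      rw [e0]; exact Pal.zero _
  · obtain ⟨ihp, ihm⟩ := ih n (by omega)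
    have low : Pal (n + 1) (X * (C (n : ℝ) * altT bp (n - 1))) ∧
        Pal (n + 2) (X * (C (n : ℝ) * altT bm (n - 1))) := by
      rcases n with _ | n
      · simp [Pal.zero]
      · obtain ⟨h1, h2⟩ := ih n (by omega)
        exact ⟨(h1.smul _).X_mul, (h2.smul _).X_mul⟩
    constructor
    · rw [rp]
      convert ((ihp.euler.smul 2).add (low.1.smul 2)).add ihm using 1
      simp only [map_natCast, map_ofNat]
      ring
    · rw [rm]
      convert (((ihm.euler.smul 2).add (low.2.smul 2)).add ihp.X_mul).add
        (ihm.one_add_X_mul.smul (-1)) using 1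
      simp only [map_natCast, map_ofNat, map_neg, map_one]
      push_cast
      ring

/-! ### Signed permutations as pairs -/

def wordOf {n : ℕ} (p : Equiv.Perm (Fin n) × (Fin n → Bool)) : Fin n → Fin n × Bool :=
  fun i => (p.1 i, p.2 (p.1 i))

lemma wordOf_injective {n : ℕ} : Function.Injective (wordOf (n := n)) := by
  rintro ⟨σ, s⟩ ⟨τ, t⟩ h
  have h1 : ∀ i, σ i = τ i ∧ s (σ i) = t (τ i) := fun i => by
    have := congrFun h i
    simpa [wordOf] using this
  have e : σ = τ := Equiv.ext fun i => (h1 i).1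
  subst e
  have e2 : s = t := by
    funext i
    simpa using (h1 (σ.symm i)).2
  rw [e2]

lemma image_wordOf (n : ℕ) :
    (univ : Finset (Equiv.Perm (Fin n) × (Fin n → Bool))).image wordOf =
      univ.filter (fun u : Fin n → Fin n × Bool => IsSP u) := by
  ext u
  simp only [mem_image, mem_univ, true_and, mem_filter]
  constructor
  · rintro ⟨p, rfl⟩
    exact p.1.bijective
  · intro h
    refine ⟨⟨Equiv.ofBijective _ h, fun k => (u ((Equiv.ofBijective _ h).symm k)).2⟩, ?_⟩
    funext i
    have e : (Equiv.ofBijective _ h).symm ((u i).1) = i :=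
      (Equiv.ofBijective _ h).symm_apply_apply i
    have e1 : (Equiv.ofBijective _ h) i = (u i).1 := rfl
    simp only [wordOf, e1, e]

lemma sum_SP {n : ℕ} (g : (Fin n → Fin n × Bool) → Polynomial ℝ) :
    ∑ u ∈ univ.filter (fun u : Fin n → Fin n × Bool => IsSP u), g u =
      ∑ p : Equiv.Perm (Fin n) × (Fin n → Bool), g (wordOf p) := by
  rw [← image_wordOf, Finset.sum_image (fun _ _ _ _ h => wordOf_injective h)]

lemma card_SP (n : ℕ) :
    (univ.filter (fun u : Fin n → Fin n × Bool => IsSP u)).card = n.factorial * 2 ^ n := by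
  rw [← image_wordOf, Finset.card_image_of_injective _ wordOf_injective]
  simp [Fintype.card_perm]

/-! ### Excedances -/

def sval {n : ℕ} (s : Fin n → Bool) (k : Fin n) : ℤ :=
  if s k then (k : ℤ) + 1 else -((k : ℤ) + 1)

abbrev isE {n : ℕ} (σ : Equiv.Perm (Fin n)) (s : Fin n → Bool) (k : Fin n) : Prop :=
  sval s k < sval s (σ k) ∨ (sval s k < 0 ∧ sval s (σ k) = sval s k)

abbrev isF {n : ℕ} (σ : Equiv.Perm (Fin n)) (s : Fin n → Bool) (k : Fin n) : Prop :=
  σ k = k ∧ s k = true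

def nE {n : ℕ} (σ : Equiv.Perm (Fin n)) (s : Fin n → Bool) : ℕ :=
  ∑ k, if isE σ s k then 1 else 0

def nF {n : ℕ} (σ : Equiv.Perm (Fin n)) (s : Fin n → Bool) : ℕ :=
  ∑ k, if isF σ s k then 1 else 0

lemma letterW_wordOf {n : ℕ} (σ : Equiv.Perm (Fin n)) (s : Fin n → Bool) (k : Fin n) :
    letterW (wordOf (σ, s)) k = sval s (σ k) := rfl

lemma aVal_wordOf {n : ℕ} (σ : Equiv.Perm (Fin n)) (s : Fin n → Bool) (k : Fin n) :
    aVal (wordOf (σ, s)) k = sval s k := by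
  have : (∃ j, wordOf (σ, s) j = (k, true)) ↔ s k = true := by
    simp only [wordOf, Prod.mk.injEq]
    constructor
    · rintro ⟨j, rfl, h⟩; exact h
    · intro h; exact ⟨σ.symm k, by simp [h]⟩
  simp only [aVal, sval, this]

lemma excB_wordOf {n : ℕ} (σ : Equiv.Perm (Fin n)) (s : Fin n → Bool) :
    excB (wordOf (σ, s)) = nE σ s := by
  simp only [excB, nE, aVal_wordOf, letterW_wordOf, Finset.card_filter]

lemma sval_pos {n : ℕ} (s : Fin n → Bool) (k : Fin n) : 0 < sval s k ↔ s k = true := by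
  unfold sval
  split_ifs with h
  · simp [h]; try omega
  · simp [h]; try omega

lemma sval_neg {n : ℕ} (s : Fin n → Bool) (k : Fin n) : sval s k < 0 ↔ s k = false := by
  unfold sval
  split_ifs with h
  · simp [h]; try omega
  · simp [h]; try omega

lemma sval_inj {n : ℕ} (s : Fin n → Bool) (k l : Fin n) : sval s k = sval s l ↔ k = l := by
  constructor
  · intro h
    unfold sval at h
    ext
    split_ifs at h <;> omega
  · rintro rfl; rfl

lemma isDerB_wordOf {n : ℕ} (σ : Equiv.Perm (Fin n)) (s : Fin n → Bool) :
    IsDerB (wordOf (σ, s)) ↔ nF σ s = 0 := by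
  simp only [IsDerB, nF, aVal_wordOf, letterW_wordOf, sval_pos, ne_eq, sval_inj]
  simp only [Finset.sum_eq_zero_iff, mem_univ, true_implies, ite_eq_right_iff, one_ne_zero,
    imp_false, isF]
  apply forall_congr'
  intro k
  tauto

noncomputable def PF (n f : ℕ) : Polynomial ℝ :=
  ∑ p : Equiv.Perm (Fin n) × (Fin n → Bool), if nF p.1 p.2 = f then X ^ nE p.1 p.2 else 0

lemma dB_eq (n : ℕ) : dB n = PF n 0 := by
  unfold dB PF
  rw [← Finset.filter_filter, Finset.sum_filter, sum_SP]
  apply Finset.sum_congr rfl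
  rintro ⟨σ, s⟩ _
  simp only [isDerB_wordOf, excB_wordOf]

noncomputable def insP {n : ℕ} (o : Option (Fin n)) (σ : Equiv.Perm (Fin n)) :
    Equiv.Perm (Fin (n + 1)) :=
  finSuccEquivLast.permCongr.symm (Equiv.Perm.decomposeOption.symm (o, σ))

lemma insP_none_last {n : ℕ} (σ : Equiv.Perm (Fin n)) :
    insP none σ (Fin.last n) = Fin.last n := by
  simp [insP, Equiv.permCongr]

lemma insP_none_castSucc {n : ℕ} (σ : Equiv.Perm (Fin n)) (j : Fin n) :
    insP none σ j.castSucc = (σ j).castSucc := by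
  simp [insP, Equiv.permCongr]

lemma insP_some_last {n : ℕ} (σ : Equiv.Perm (Fin n)) (k : Fin n) :
    insP (some (σ k)) σ (Fin.last n) = (σ k).castSucc := by
  simp [insP, Equiv.permCongr]

lemma insP_some_castSucc {n : ℕ} (σ : Equiv.Perm (Fin n)) (k j : Fin n) :
    insP (some (σ k)) σ j.castSucc = if j = k then Fin.last n else (σ j).castSucc := by
  split_ifs with h
  · subst h
    simp [insP, Equiv.permCongr]
  · simp only [insP, Equiv.permCongr]
    simp
    rw [Equiv.swap_apply_of_ne_of_ne] <;> simp [h]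

lemma sum_insP {n : ℕ} (G : Equiv.Perm (Fin (n + 1)) → Polynomial ℝ) :
    ∑ τ, G τ = ∑ σ : Equiv.Perm (Fin n),
      (G (insP none σ) + ∑ k, G (insP (some (σ k)) σ)) := by
  have h := Equiv.sum_comp (finSuccEquivLast (n := n)).permCongr.symm G
  have h2 := Equiv.sum_comp (Equiv.Perm.decomposeOption (α := Fin n)).symm
    (fun x => G ((finSuccEquivLast (n := n)).permCongr.symm x))
  rw [← h, ← h2, Fintype.sum_prod_type_right]
  apply Finset.sum_congr rfl
  intro σ _
  rw [Fintype.sum_option]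
  congr 1
  exact (Equiv.sum_comp σ (fun j => G (insP (some j) σ))).symm

lemma sum_snoc {n : ℕ} (G : (Fin (n + 1) → Bool) → Polynomial ℝ) :
    ∑ t, G t = ∑ s : Fin n → Bool, ∑ b : Bool, G (Fin.snoc (α := fun _ => Bool) s b) := by
  rw [← Equiv.sum_comp (Fin.snocEquiv (fun _ : Fin (n + 1) => Bool)) G, Fintype.sum_prod_type_right]
  rfl

lemma sval_snoc_castSucc {n : ℕ} (s : Fin n → Bool) (b : Bool) (k : Fin n) :
    sval (Fin.snoc (α := fun _ => Bool) s b) k.castSucc = sval s k := by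
  simp [sval]

lemma sval_snoc_last {n : ℕ} (s : Fin n → Bool) (b : Bool) :
    sval (Fin.snoc (α := fun _ => Bool) s b) (Fin.last n) = if b then (n : ℤ) + 1 else -(n + 1) := by
  simp [sval]

lemma sval_bound {n : ℕ} (s : Fin n → Bool) (k : Fin n) :
    -((n : ℤ) + 1) < sval s k ∧ sval s k < n + 1 := by
  unfold sval
  split_ifs <;> omega

lemma nE_none {n : ℕ} (σ : Equiv.Perm (Fin n)) (s : Fin n → Bool) (b : Bool) :
    nE (insP none σ) (Fin.snoc (α := fun _ => Bool) s b) = nE σ s + if b then 0 else 1 := by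
  simp only [nE, Fin.sum_univ_castSucc, isE, insP_none_last, insP_none_castSucc,
    sval_snoc_castSucc, sval_snoc_last]
  congr 1
  cases b <;> simp <;> omega

lemma nF_none {n : ℕ} (σ : Equiv.Perm (Fin n)) (s : Fin n → Bool) (b : Bool) :
    nF (insP none σ) (Fin.snoc (α := fun _ => Bool) s b) = nF σ s + if b then 1 else 0 := by
  simp only [nF, Fin.sum_univ_castSucc, isF, insP_none_last, insP_none_castSucc]
  simp

lemma nE_some {n : ℕ} (σ : Equiv.Perm (Fin n)) (s : Fin n → Bool) (b : Bool) (k : Fin n) :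
    nE (insP (some (σ k)) σ) (Fin.snoc (α := fun _ => Bool) s b) +
      (if isE σ s k then 1 else 0) = nE σ s + 1 := by
  simp only [nE, Fin.sum_univ_castSucc, isE, insP_some_last, insP_some_castSucc,
    sval_snoc_castSucc, sval_snoc_last]
  rw [← Finset.add_sum_erase _ _ (mem_univ k)]
  rw [← Finset.add_sum_erase univ (fun j => if sval s j < sval s (σ j) ∨ (sval s j < 0 ∧
    sval s (σ j) = sval s j) then 1 else 0) (mem_univ k)]
  have h : ∀ j ∈ univ.erase k, (if sval s j < sval (Fin.snoc (α := fun _ => Bool) s b)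
      (if j = k then Fin.last n else (σ j).castSucc) ∨ (sval s j < 0 ∧
      sval (Fin.snoc (α := fun _ => Bool) s b)
      (if j = k then Fin.last n else (σ j).castSucc) = sval s j) then 1 else 0) =
      if sval s j < sval s (σ j) ∨ (sval s j < 0 ∧ sval s (σ j) = sval s j) then 1 else 0 := by
    intro j hj
    rw [if_neg (Finset.ne_of_mem_erase hj), sval_snoc_castSucc]
  rw [Finset.sum_congr rfl h, if_pos rfl, sval_snoc_last]
  have b1 := sval_bound s k
  have b2 := sval_bound s (σ k)
  generalize sval s k = x at *
  generalize sval s (σ k) = y at *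
  generalize ∑ j ∈ univ.erase k, (if sval s j < sval s (σ j) ∨ (sval s j < 0 ∧
    sval s (σ j) = sval s j) then 1 else 0) = z
  cases b
  · have c1 : ¬ (x < -((n : ℤ) + 1) ∨ x < 0 ∧ -((n : ℤ) + 1) = x) := by omega
    have c2 : (-((n : ℤ) + 1) < y ∨ -((n : ℤ) + 1) < 0 ∧ y = -((n : ℤ) + 1)) := by omega
    simp only [Bool.false_eq_true, if_false, c1, c2, if_true]; omega
  · have c1 : (x < ((n : ℤ) + 1) ∨ x < 0 ∧ ((n : ℤ) + 1) = x) := by omega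
    have c2 : ¬ (((n : ℤ) + 1) < y ∨ ((n : ℤ) + 1) < 0 ∧ y = ((n : ℤ) + 1)) := by omega
    simp only [if_true, c1, c2, if_false]; omega

lemma nF_some {n : ℕ} (σ : Equiv.Perm (Fin n)) (s : Fin n → Bool) (b : Bool) (k : Fin n) :
    nF (insP (some (σ k)) σ) (Fin.snoc (α := fun _ => Bool) s b) +
      (if isF σ s k then 1 else 0) = nF σ s := by
  simp only [nF, Fin.sum_univ_castSucc, isF, insP_some_last, insP_some_castSucc]
  rw [← Finset.add_sum_erase _ _ (mem_univ k)]
  rw [← Finset.add_sum_erase univ (fun j => if σ j = j ∧ s j = true then 1 else 0) (mem_univ k)]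
  have h : ∀ j ∈ univ.erase k, (if (if j = k then Fin.last n else (σ j).castSucc) = j.castSucc ∧
      Fin.snoc (α := fun _ => Bool) s b j.castSucc = true then 1 else 0) =
      if σ j = j ∧ s j = true then 1 else 0 := by
    intro j hj
    rw [if_neg (Finset.ne_of_mem_erase hj)]
    simp
  rw [Finset.sum_congr rfl h]
  have h1 : Fin.last n ≠ k.castSucc := (Fin.castSucc_lt_last k).ne'
  have h2 : (σ k).castSucc ≠ Fin.last n := (Fin.castSucc_lt_last (σ k)).ne
  simp [h1, h2, add_comm]

lemma not_isF_of_isE {n : ℕ} (σ : Equiv.Perm (Fin n)) (s : Fin n → Bool) (k : Fin n)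
    (h : isE σ s k) : ¬ isF σ s k := by
  rintro ⟨h1, h2⟩
  simp only [isE, h1, lt_self_iff_false, sval_neg, h2] at h
  simp at h

lemma sum_arcs {n : ℕ} (σ : Equiv.Perm (Fin n)) (s : Fin n → Bool) (b : Bool) (f : ℕ) :
    (∑ k, if nF (insP (some (σ k)) σ) (Fin.snoc (α := fun _ => Bool) s b) = f then
      (X : Polynomial ℝ) ^ nE (insP (some (σ k)) σ) (Fin.snoc (α := fun _ => Bool) s b) else 0) =
    X * (1 - X) * derivative (if nF σ s = f then X ^ nE σ s else 0)
      + X * (((n : Polynomial ℝ) - (f : Polynomial ℝ)) * (if nF σ s = f then X ^ nE σ s else 0))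
      + X * (((f : Polynomial ℝ) + 1) * (if nF σ s = f + 1 then X ^ nE σ s else 0)) := by
  have hk : ∀ k, (if nF (insP (some (σ k)) σ) (Fin.snoc (α := fun _ => Bool) s b) = f then
      (X : Polynomial ℝ) ^ nE (insP (some (σ k)) σ) (Fin.snoc (α := fun _ => Bool) s b) else 0) =
      ((if isE σ s k then 1 else 0 : ℕ) : Polynomial ℝ) * (if nF σ s = f then X ^ nE σ s else 0) +
      ((if isF σ s k then 1 else 0 : ℕ) : Polynomial ℝ) *
        (if nF σ s = f + 1 then X ^ (nE σ s + 1) else 0) +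
      (1 - ((if isE σ s k then 1 else 0 : ℕ) : Polynomial ℝ) -
        ((if isF σ s k then 1 else 0 : ℕ) : Polynomial ℝ)) *
        (if nF σ s = f then X ^ (nE σ s + 1) else 0) := by
    intro k
    have h1 := nE_some σ s b k
    have h2 := nF_some σ s b k
    have h3 := not_isF_of_isE σ s k
    by_cases hE : isE σ s k
    · have hF := h3 hE
      rw [if_pos hE] at h1
      rw [if_neg hF] at h2
      rw [if_pos hE, if_neg hF, ← h2, show nE σ s = _ from (Nat.succ.inj h1).symm]
      simp
    · rw [if_neg hE] at h1
      by_cases hF : isF σ s k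
      · rw [if_pos hF] at h2
        rw [if_neg hE, if_pos hF, ← h2, ← h1]
        simp
      · rw [if_neg hF] at h2
        rw [if_neg hE, if_neg hF, ← h2, ← h1]
        simp
  rw [Finset.sum_congr rfl (fun k _ => hk k), Finset.sum_add_distrib, Finset.sum_add_distrib,
    ← Finset.sum_mul, ← Finset.sum_mul, ← Finset.sum_mul, Finset.sum_sub_distrib,
    Finset.sum_sub_distrib, ← Nat.cast_sum, ← Nat.cast_sum]
  have e1 : (∑ k, if isE σ s k then 1 else 0) = nE σ s := rfl
  have e2 : (∑ k, if isF σ s k then 1 else 0) = nF σ s := rfl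
  have hX : ∀ m : ℕ, (X : Polynomial ℝ) * derivative (X ^ m) = (m : Polynomial ℝ) * X ^ m := by
    intro m
    cases m with
    | zero => simp
    | succ m => rw [derivative_X_pow]; simp [pow_succ]; ring
  rw [e1, e2]
  simp only [sum_const, card_univ, Fintype.card_fin, nsmul_eq_mul, mul_one]
  by_cases c1 : nF σ s = f
  · have c2 : nF σ s ≠ f + 1 := by omega
    rw [if_pos c1, if_pos c1, if_neg c2, if_neg c2, c1]
    linear_combination (X - 1) * hX (nE σ s)
  · rw [if_neg c1, if_neg c1]
    by_cases c2 : nF σ s = f + 1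
    · rw [if_pos c2, if_pos c2, c2]
      simp
      ring
    · rw [if_neg c2, if_neg c2]; simp

lemma PF_succ (n f : ℕ) : PF (n + 1) f =
    (if f = 0 then 0 else PF n (f - 1)) + X * PF n f +
    2 * (X * (1 - X) * derivative (PF n f) + X * (((n : Polynomial ℝ) - (f : Polynomial ℝ)) * PF n f)
      + X * (((f : Polynomial ℝ) + 1) * PF n (f + 1))) := by
  have h0 : (if f = 0 then 0 else PF n (f - 1)) =
      ∑ p : Equiv.Perm (Fin n) × (Fin n → Bool),
        if nF p.1 p.2 + 1 = f then (X : Polynomial ℝ) ^ nE p.1 p.2 else 0 := by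
    rcases f with _ | f
    · simp
    · simp [PF]
  rw [h0]
  unfold PF
  rw [Fintype.sum_prod_type, sum_insP]
  simp only [derivative_sum, Finset.mul_sum, ← Finset.sum_add_distrib]
  rw [Fintype.sum_prod_type]
  apply Finset.sum_congr rfl
  intro σ _
  rw [sum_snoc]
  have hc : ∀ k, (∑ t : Fin (n + 1) → Bool, if nF (insP (some (σ k)) σ) t = f then
      (X : Polynomial ℝ) ^ nE (insP (some (σ k)) σ) t else 0) = _ := fun k => sum_snoc _
  simp only [hc]
  rw [Finset.sum_comm (s := (univ : Finset (Fin n))) (t := (univ : Finset (Fin n → Bool))),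
    ← Finset.sum_add_distrib]
  apply Finset.sum_congr rfl
  intro s _
  rw [Finset.sum_comm]
  simp only [sum_arcs, nE_none, nF_none, Fintype.sum_bool, if_true, Bool.false_eq_true, if_false,
    add_zero]
  by_cases c : nF σ s = f
  · simp only [c, if_true, pow_succ]; ring
  · simp only [c, if_false]; ring

lemma PF_zero (f : ℕ) : PF 0 f = if f = 0 then 1 else 0 := by
  unfold PF
  simp [nF, nE, eq_comm]

/-- Solving the recurrence. -/
lemma PF_eq (δ : ℕ → Polynomial ℝ) (h0 : δ 0 = 1)
    (h : ∀ m, δ (m + 1) = X * δ m + 2 * X * (1 - X) * derivative (δ m)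
      + 2 * X * ((m : Polynomial ℝ) * δ m + (m : Polynomial ℝ) * δ (m - 1))) (n : ℕ) :
    ∀ f, PF n f = (n.choose f : Polynomial ℝ) * δ (n - f) := by
  induction n with
  | zero =>
    intro f
    rw [PF_zero]
    rcases f with _ | f <;> simp [h0]
  | succ n ih =>
    intro f
    have hd : derivative ((n.choose f : Polynomial ℝ) * δ (n - f)) =
        (n.choose f : Polynomial ℝ) * derivative (δ (n - f)) := by
      rw [← map_natCast C, derivative_C_mul]
    have hlow : (if f = 0 then 0 else PF n (f - 1)) =
        (((n + 1).choose f : Polynomial ℝ) - n.choose f) * δ (n + 1 - f) := by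
      rcases f with _ | f
      · simp
      · rw [if_neg (by omega), ih, Nat.choose_succ_succ]
        simp
    rw [PF_succ, hlow, ih f, ih (f + 1), hd]
    rcases le_or_gt f n with hf | hf
    · obtain ⟨m, rfl⟩ : ∃ m, n = f + m := ⟨n - f, by omega⟩
      have e1 : f + m + 1 - f = m + 1 := by omega
      have e2 : f + m - f = m := by omega
      have e3 : f + m - (f + 1) = m - 1 := by omega
      rw [e1, e2, e3, h m]
      have key : ((f + 1 : ℕ) : Polynomial ℝ) * ((f + m).choose (f + 1) : Polynomial ℝ) =
          (m : Polynomial ℝ) * ((f + m).choose f : Polynomial ℝ) := by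
        have := Nat.choose_succ_right_eq (f + m) f
        rw [e2] at this
        exact_mod_cast (by rw [mul_comm, this, mul_comm] :
          (f + 1) * (f + m).choose (f + 1) = m * (f + m).choose f)
      push_cast at key ⊢
      linear_combination 2 * X * δ (m - 1) * key
    · have e1 : n.choose f = 0 := Nat.choose_eq_zero_of_lt hf
      have e2 : n.choose (f + 1) = 0 := Nat.choose_eq_zero_of_lt (by omega)
      rw [e1, e2]
      simp

/-! ### Descents -/

def wv {n : ℕ} (u : Fin n → Fin n × Bool) : ℕ → ℤ
  | 0 => 0
  | i + 1 => if h : i < n then letterW u ⟨i, h⟩ else 0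

lemma desB_eq {n : ℕ} (u : Fin n → Fin n × Bool) :
    desB u = ∑ i ∈ Finset.range n, if wv u (i + 1) < wv u i then 1 else 0 := by
  rw [desB, Finset.card_filter, Finset.sum_range]
  apply Finset.sum_congr rfl
  rintro ⟨i, hi⟩ _
  rcases i with _ | i
  · simp [wv, hi]
  · have h' : i < n := by omega
    simp [wv, hi, h']

lemma letterW_bound {n : ℕ} (u : Fin n → Fin n × Bool) (k : Fin n) :
    -((n : ℤ) + 1) < letterW u k ∧ letterW u k < n + 1 := by
  unfold letterW
  split_ifs <;> omega

lemma wv_bound {n : ℕ} (u : Fin n → Fin n × Bool) (i : ℕ) :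
    -((n : ℤ) + 1) < wv u i ∧ wv u i < n + 1 := by
  rcases i with _ | i
  · simp [wv]; omega
  · simp only [wv]
    split_ifs with h
    · exact letterW_bound u _
    · omega

def insW {n : ℕ} (p : Fin (n + 1)) (b : Bool) (u : Fin n → Fin n × Bool) :
    Fin (n + 1) → Fin (n + 1) × Bool :=
  p.insertNth (α := fun _ => Fin (n + 1) × Bool) (Fin.last n, b)
    (fun j => ((u j).1.castSucc, (u j).2))

lemma insW_same {n : ℕ} (p : Fin (n + 1)) (b : Bool) (u : Fin n → Fin n × Bool) :
    insW p b u p = (Fin.last n, b) := by simp [insW]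

lemma insW_succAbove {n : ℕ} (p : Fin (n + 1)) (b : Bool) (u : Fin n → Fin n × Bool) (j : Fin n) :
    insW p b u (p.succAbove j) = ((u j).1.castSucc, (u j).2) := by simp [insW]

lemma letterW_insW_same {n : ℕ} (p : Fin (n + 1)) (b : Bool) (u : Fin n → Fin n × Bool) :
    letterW (insW p b u) p = if b then (n : ℤ) + 1 else -((n : ℤ) + 1) := by
  simp [letterW, insW_same]

lemma letterW_insW_succAbove {n : ℕ} (p : Fin (n + 1)) (b : Bool) (u : Fin n → Fin n × Bool)
    (j : Fin n) : letterW (insW p b u) (p.succAbove j) = letterW u j := by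
  simp [letterW, insW_succAbove]

lemma wv_insW_le {n : ℕ} (p : Fin (n + 1)) (b : Bool) (u : Fin n → Fin n × Bool) (i : ℕ)
    (hi : i ≤ p) : wv (insW p b u) i = wv u i := by
  rcases i with _ | i
  · rfl
  · have h1 : i < n := by omega
    have h2 : i < n + 1 := by omega
    simp only [wv, h1, h2, dif_pos]
    rw [← letterW_insW_succAbove p b u ⟨i, h1⟩]
    congr 1
    rw [Fin.succAbove_of_castSucc_lt _ _ (by rw [Fin.lt_def]; simpa using hi)]
    rfl

lemma wv_insW_same {n : ℕ} (p : Fin (n + 1)) (b : Bool) (u : Fin n → Fin n × Bool) :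
    wv (insW p b u) (p + 1) = if b then (n : ℤ) + 1 else -((n : ℤ) + 1) := by
  simp only [wv, p.isLt, dif_pos]
  exact letterW_insW_same p b u

lemma wv_insW_gt {n : ℕ} (p : Fin (n + 1)) (b : Bool) (u : Fin n → Fin n × Bool) (i : ℕ)
    (hi : (p : ℕ) < i) : wv (insW p b u) (i + 1) = wv u i := by
  obtain ⟨i, rfl⟩ : ∃ k, i = k + 1 := ⟨i - 1, by omega⟩
  by_cases h1 : i < n
  · have h2 : i + 1 < n + 1 := by omega
    simp only [wv, h1, h2, dif_pos]
    rw [← letterW_insW_succAbove p b u ⟨i, h1⟩]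
    congr 1
    rw [Fin.succAbove_of_le_castSucc _ _ (by rw [Fin.le_def]; simp; omega)]
    rfl
  · have h2 : ¬ i + 1 < n + 1 := by omega
    simp [wv, h1, h2]

lemma insW_isSP {n : ℕ} (p : Fin (n + 1)) (b : Bool) (u : Fin n → Fin n × Bool) (hu : IsSP u) :
    IsSP (insW p b u) := by
  unfold IsSP
  rw [← Finite.injective_iff_bijective]
  intro i j h
  simp only at h
  rcases Fin.eq_self_or_eq_succAbove p i with hi | ⟨i, rfl⟩ <;>
    rcases Fin.eq_self_or_eq_succAbove p j with hj | ⟨j, rfl⟩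
  · exact hi.trans hj.symm
  · rw [hi, insW_same, insW_succAbove] at h
    exact absurd h (Fin.castSucc_lt_last _).ne'
  · rw [hj, insW_same, insW_succAbove] at h
    exact absurd h (Fin.castSucc_lt_last _).ne
  · rw [insW_succAbove, insW_succAbove] at h
    rw [hu.1 (Fin.castSucc_injective _ h)]

lemma insW_injective {n : ℕ} : Function.Injective
    (fun x : Fin (n + 1) × Bool × (Fin n → Fin n × Bool) => insW x.1 x.2.1 x.2.2) := by
  rintro ⟨p, b, u⟩ ⟨q, c, v⟩ h
  simp only at h
  have hp := congrFun h p
  rw [insW_same] at hp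
  obtain rfl : p = q := by
    rcases Fin.eq_self_or_eq_succAbove q p with h | ⟨i, rfl⟩
    · exact h
    · rw [insW_succAbove] at hp
      exact absurd (congrArg Prod.fst hp) (Fin.castSucc_lt_last _).ne'
  rw [insW_same] at hp
  obtain rfl : b = c := congrArg Prod.snd hp
  have : u = v := by
    funext j
    have := congrFun h (p.succAbove j)
    rw [insW_succAbove, insW_succAbove] at this
    have h1 := Fin.castSucc_injective _ (congrArg Prod.fst this)
    have h2 := congrArg Prod.snd this
    exact Prod.ext h1 h2
  rw [this]

lemma sum_insW {n : ℕ} (G : (Fin (n + 1) → Fin (n + 1) × Bool) → Polynomial ℝ) :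
    ∑ u ∈ univ.filter (fun u : Fin (n + 1) → Fin (n + 1) × Bool => IsSP u), G u =
    ∑ u ∈ univ.filter (fun u : Fin n → Fin n × Bool => IsSP u), ∑ b : Bool,
      ((∑ q : Fin n, G (insW q.castSucc b u)) + G (insW (Fin.last n) b u)) := by
  have him : ((univ : Finset (Fin (n + 1))) ×ˢ ((univ : Finset Bool) ×ˢ
      univ.filter (fun u : Fin n → Fin n × Bool => IsSP u))).image
      (fun x : Fin (n + 1) × Bool × (Fin n → Fin n × Bool) => insW x.1 x.2.1 x.2.2) =
      univ.filter (fun u : Fin (n + 1) → Fin (n + 1) × Bool => IsSP u) := by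
    apply Finset.eq_of_subset_of_card_le
    · intro w hw
      simp only [mem_image, mem_product, mem_univ, true_and, mem_filter] at hw ⊢
      obtain ⟨x, hx, rfl⟩ := hw
      exact insW_isSP _ _ _ hx
    · rw [Finset.card_image_of_injective _ insW_injective, card_product, card_product, card_SP,
        card_SP]
      simp only [card_univ, Fintype.card_fin, Fintype.card_bool, Nat.factorial_succ, pow_succ]
      apply le_of_eq
      ring
  rw [← him, Finset.sum_image (fun _ _ _ _ h => insW_injective h), Finset.sum_product,
    Finset.sum_congr rfl (fun p _ => Finset.sum_product _ _ _), Finset.sum_comm]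
  rw [Finset.sum_congr rfl (fun b _ => Finset.sum_comm), Finset.sum_comm]
  apply Finset.sum_congr rfl
  intro u _
  apply Finset.sum_congr rfl
  intro b _
  rw [Fin.sum_univ_castSucc]

lemma des_last {n : ℕ} (b : Bool) (u : Fin n → Fin n × Bool) :
    desB (insW (Fin.last n) b u) = desB u + if b then 0 else 1 := by
  rw [desB_eq, desB_eq, Finset.sum_range_succ]
  have h := wv_insW_same (Fin.last n) b u
  have h' := wv_insW_le (Fin.last n) b u n (by simp)
  rw [Fin.val_last] at h
  rw [h, h']
  congr 1
  · apply Finset.sum_congr rfl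
    intro i hi
    have := Finset.mem_range.1 hi
    rw [wv_insW_le _ _ _ _ (by rw [Fin.val_last]; omega),
      wv_insW_le _ _ _ _ (by rw [Fin.val_last]; omega)]
  · have := wv_bound u n
    cases b
    · simp; omega
    · simp; omega

lemma des_castSucc {n : ℕ} (b : Bool) (u : Fin n → Fin n × Bool) (q : Fin n) :
    desB (insW q.castSucc b u) + (if wv u (q + 1) < wv u q then 1 else 0) = desB u + 1 := by
  rw [desB_eq, desB_eq]
  obtain ⟨r, hr⟩ : ∃ r, n = q + 1 + r := ⟨n - (q + 1), by omega⟩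
  have hn1 : n + 1 = (q + 1 + 1) + r := by omega
  have h0 : (∑ i ∈ Finset.range n, if wv u (i + 1) < wv u i then 1 else 0) =
      ∑ i ∈ Finset.range (q + 1 + r), if wv u (i + 1) < wv u i then 1 else 0 := by rw [← hr]
  have h1 : (∑ i ∈ Finset.range (n + 1), if wv (insW q.castSucc b u) (i + 1) <
      wv (insW q.castSucc b u) i then 1 else 0) =
      ∑ i ∈ Finset.range (q + 1 + 1 + r), if wv (insW q.castSucc b u) (i + 1) <
      wv (insW q.castSucc b u) i then 1 else 0 := by
    congr 1
    rw [hn1]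
  rw [h0, h1, Finset.sum_range_add, Finset.sum_range_succ, Finset.sum_range_succ,
    Finset.sum_range_add, Finset.sum_range_succ]
  have hs := wv_insW_same q.castSucc b u
  have hg := wv_insW_gt q.castSucc b u (q + 1) (by simp)
  have hl := wv_insW_le q.castSucc b u q (by simp)
  rw [Fin.val_castSucc] at hs
  rw [hs, hg, hl]
  have t1 : (∑ i ∈ Finset.range q, if wv (insW q.castSucc b u) (i + 1) <
      wv (insW q.castSucc b u) i then 1 else 0) =
      ∑ i ∈ Finset.range q, if wv u (i + 1) < wv u i then 1 else 0 := by
    apply Finset.sum_congr rfl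
    intro i hi
    have := Finset.mem_range.1 hi
    rw [wv_insW_le _ _ _ _ (by rw [Fin.val_castSucc]; omega),
      wv_insW_le _ _ _ _ (by rw [Fin.val_castSucc]; omega)]
  have t2 : (∑ i ∈ Finset.range r, if wv (insW q.castSucc b u) ((q : ℕ) + 1 + 1 + i + 1) <
      wv (insW q.castSucc b u) ((q : ℕ) + 1 + 1 + i) then 1 else 0) =
      ∑ i ∈ Finset.range r, if wv u ((q : ℕ) + 1 + i + 1) < wv u ((q : ℕ) + 1 + i) then 1 else 0 := by
    apply Finset.sum_congr rfl
    intro i hi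
    have e1 : (q : ℕ) + 1 + 1 + i + 1 = ((q : ℕ) + 1 + i + 1) + 1 := by omega
    have e2 : (q : ℕ) + 1 + 1 + i = ((q : ℕ) + 1 + i) + 1 := by omega
    rw [e1, e2, wv_insW_gt _ _ _ _ (by rw [Fin.val_castSucc]; omega),
      wv_insW_gt _ _ _ _ (by rw [Fin.val_castSucc]; omega)]
  rw [t1, t2]
  have b1 := wv_bound u q
  have b2 := wv_bound u (q + 1)
  generalize wv u q = x at *
  generalize wv u (q + 1) = y at *
  cases b
  · have c1 : -((n : ℤ) + 1) < x := by omega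
    have c2 : ¬ y < -((n : ℤ) + 1) := by omega
    simp only [Bool.false_eq_true, if_false, c1, c2, if_true]; omega
  · have c1 : ¬ ((n : ℤ) + 1) < x := by omega
    have c2 : y < ((n : ℤ) + 1) := by omega
    simp only [if_true, c1, c2, if_false]; omega


lemma sum_gaps {n : ℕ} (b : Bool) (u : Fin n → Fin n × Bool) :
    (∑ q : Fin n, (X : Polynomial ℝ) ^ desB (insW q.castSucc b u)) =
      X * (1 - X) * derivative (X ^ desB u) + X * ((n : Polynomial ℝ) * X ^ desB u) := by
  have hk : ∀ q : Fin n, (X : Polynomial ℝ) ^ desB (insW q.castSucc b u) =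
      ((if wv u (q + 1) < wv u q then 1 else 0 : ℕ) : Polynomial ℝ) * (X ^ desB u) +
      (1 - ((if wv u (q + 1) < wv u q then 1 else 0 : ℕ) : Polynomial ℝ)) * X ^ (desB u + 1) := by
    intro q
    have h := des_castSucc b u q
    split_ifs at h ⊢ with c
    · rw [← Nat.succ.inj h]; simp
    · rw [← h]; simp
  rw [Finset.sum_congr rfl (fun q _ => hk q), Finset.sum_add_distrib, ← Finset.sum_mul,
    ← Finset.sum_mul, Finset.sum_sub_distrib, ← Nat.cast_sum]
  have e : (∑ q : Fin n, if wv u (q + 1) < wv u q then 1 else 0) = desB u := by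
    rw [desB_eq, Finset.sum_range]
  have hX : ∀ m : ℕ, (X : Polynomial ℝ) * derivative (X ^ m) = (m : Polynomial ℝ) * X ^ m := by
    intro m
    cases m with
    | zero => simp
    | succ m => rw [derivative_X_pow]; simp [pow_succ]; ring
  rw [e]
  simp only [sum_const, card_univ, Fintype.card_fin, nsmul_eq_mul, mul_one]
  linear_combination (X - 1) * hX (desB u)

noncomputable def bNeg (n : ℕ) : Polynomial ℝ :=
  ∑ u ∈ univ.filter (fun u : Fin n → Fin n × Bool => IsSP u),
    if wv u n < 0 then X ^ desB u else 0

noncomputable def bPos (n : ℕ) : Polynomial ℝ :=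
  ∑ u ∈ univ.filter (fun u : Fin n → Fin n × Bool => IsSP u),
    if wv u n < 0 then 0 else X ^ desB u

lemma wv_last_castSucc {n : ℕ} (b : Bool) (u : Fin n → Fin n × Bool) (q : Fin n) :
    wv (insW q.castSucc b u) (n + 1) = wv u n :=
  wv_insW_gt _ _ _ _ (by simp)

lemma wv_last_last {n : ℕ} (b : Bool) (u : Fin n → Fin n × Bool) :
    wv (insW (Fin.last n) b u) (n + 1) < 0 ↔ b = false := by
  have h := wv_insW_same (Fin.last n) b u
  rw [Fin.val_last] at h
  rw [h]
  cases b
  · simp; omega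
  · simp; omega

lemma bNeg_succ (n : ℕ) : bNeg (n + 1) = 2 * X * (1 - X) * derivative (bNeg n)
    + 2 * X * ((n : Polynomial ℝ) * bNeg n) + X * (bPos n + bNeg n) := by
  unfold bNeg bPos
  rw [sum_insW]
  simp only [derivative_sum, Finset.mul_sum, ← Finset.sum_add_distrib]
  apply Finset.sum_congr rfl
  intro u _
  simp only [wv_last_castSucc, wv_last_last, Fintype.sum_bool, des_last]
  by_cases c : wv u n < 0
  · simp only [c, if_true, sum_gaps, Bool.true_eq_false, Bool.false_eq_true, if_false, pow_succ]
    ring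
  · simp [c, pow_succ]
    try ring

lemma bPos_succ (n : ℕ) : bPos (n + 1) = 2 * X * (1 - X) * derivative (bPos n)
    + 2 * X * ((n : Polynomial ℝ) * bPos n) + (bPos n + bNeg n) := by
  unfold bNeg bPos
  rw [sum_insW]
  simp only [derivative_sum, Finset.mul_sum, ← Finset.sum_add_distrib]
  apply Finset.sum_congr rfl
  intro u _
  simp only [wv_last_castSucc, wv_last_last, Fintype.sum_bool, des_last]
  by_cases c : wv u n < 0
  · simp [c]
  · simp only [c, if_true, sum_gaps, Bool.true_eq_false, Bool.false_eq_true, if_false, pow_succ]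
    ring

lemma filter_SP_zero : (univ.filter (fun u : Fin 0 → Fin 0 × Bool => IsSP u)) = univ := by
  apply Finset.filter_true_of_mem
  intro u _
  exact ⟨fun i => i.elim0, fun i => i.elim0⟩

lemma bNeg_zero : bNeg 0 = 0 := by
  simp [bNeg, wv]

lemma bPos_zero : bPos 0 = 1 := by
  rw [bPos, filter_SP_zero]
  simp [wv, desB]

lemma Bminus_eq (n : ℕ) : Bminus n = bNeg n := by
  rcases n with _ | n
  · rw [bNeg_zero]; rfl
  · simp only [Bminus, bNeg]
    rw [← Finset.filter_filter, Finset.sum_filter]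
    apply Finset.sum_congr rfl
    intro u _
    have : wv u (n + 1) = letterW u (Fin.last n) := by
      simp [wv, Fin.last]
    rw [this]

lemma pal_of {N : ℕ} {g : Polynomial ℝ} (hd : g.degree ≤ (N : WithBot ℕ))
    (hs : ∀ k ≤ N, g.coeff k = g.coeff (N - k)) : Pal N g := by
  refine ⟨fun i j e => ?_, fun i hi => ?_⟩
  · rw [hs i (by omega)]; congr 1; omega
  · exact coeff_eq_zero_of_degree_lt (lt_of_le_of_lt hd (by exact_mod_cast hi))

/-- `f_n^-(x) = Σ_{k=0}^n (−1)^{n−k} (n choose k) B_k^-(x)`. -/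
theorem fminus_eq_alternating_sum_Bminus (n : ℕ)
    (fp fm : Polynomial ℝ)
    (hsum : dB n = fp + fm)
    (hpdeg : fp.degree ≤ (n : WithBot ℕ))
    (hpsymm : ∀ k ≤ n, fp.coeff k = fp.coeff (n - k))
    (hmdeg : fm.degree ≤ ((n + 1 : ℕ) : WithBot ℕ))
    (hmsymm : ∀ k ≤ n + 1, fm.coeff k = fm.coeff (n + 1 - k))
    :
    fm = ∑ k ∈ Finset.range (n + 1),
      (-1 : Polynomial ℝ) ^ (n - k) * (n.choose k : Polynomial ℝ) * Bminus k := by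
  have hgoal : ∑ k ∈ Finset.range (n + 1),
      (-1 : Polynomial ℝ) ^ (n - k) * (n.choose k : Polynomial ℝ) * Bminus k = altT bNeg n := by
    simp only [altT, Bminus_eq]
  rw [hgoal]
  obtain ⟨p1, p2⟩ := altT_pal bPos bNeg bPos_zero bNeg_zero bPos_succ bNeg_succ n
  have rp := altT_rec bPos _ bPos_succ
  have rm := altT_rec bNeg _ bNeg_succ
  simp only [altT_add, altT_smul] at rp rm
  have hd : dB n = altT bPos n + altT bNeg n := by
    rw [dB_eq, PF_eq (fun m => altT bPos m + altT bNeg m)]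
    · simp
    · simp [altT, bPos_zero, bNeg_zero]
    · intro m
      simp only [rp, rm, derivative_add]
      ring
  have q1 := pal_of hpdeg hpsymm
  have q2 := pal_of hmdeg hmsymm
  have e : fm + C (-1) * altT bNeg n = altT bPos n + C (-1) * fp := by
    have := hsum.symm.trans hd
    simp only [map_neg, map_one]
    linear_combination this
  have z := Pal.eq_zero (N := n) (g := fm + C (-1) * altT bNeg n)
    (by rw [e]; exact p1.add (q1.smul _)) (q2.add (p2.smul _))
  simp only [map_neg, map_one] at z
  linear_combination z
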